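/- arXiv:1202.5610 — 4 statements merged into one kernel-verified Lean document; each statement's English description precedes it below -/
import Mathlib

section
/- Let G be a finite connected simple graph with a nonnegative real weight w(e) on each edge, and let T be a minimum spanning tree of G, i.e., a spanning subgraph of G that is a tree and whose total edge weight is minimal among all spanning trees of G. Then for any two vertices u, v of G, the maximum edge weight along the (unique) path between u and v in T is at most the maximum edge weight along any walk between u and v in G. In other words, paths in a minimum spanning tree are bottleneck shortest paths. -/
open scoped BigOperators

theorem exists_crossing_dart {V : Type*} {G D : SimpleGraph V} {u v : V} (q : G.Walk u v)
    (h : ¬ D.Reachable u v) :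
    ∃ x y, s(x, y) ∈ q.edges ∧ G.Adj x y ∧ ¬ D.Reachable x y := by
  induction q with
  | nil => exact absurd (SimpleGraph.Reachable.refl _) h
  | @cons a b c hab q ih =>
    by_cases hr : D.Reachable a b
    · obtain ⟨x, y, h1, h2, h3⟩ := ih (fun h' => h (hr.trans h'))
      exact ⟨x, y, by simp [h1], h2, h3⟩
    · exact ⟨a, b, by simp, hab, hr⟩

/-- In a finite connected weighted simple graph `G` with nonnegative
edge weights, if `T` is a minimum spanning tree of `G`, then for all vertices
`u, v`, the maximum edge weight along any path `p` from `u` to `v` in `T` is at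
most the maximum edge weight along any walk `q` from `u` to `v` in `G`:
paths in an MST are bottleneck shortest paths. -/
theorem mst_path_is_bottleneck_shortest {V : Type*} [Fintype V]
    (G : SimpleGraph V) (hG : G.Connected)
    (w : Sym2 V → ℝ) (hw : ∀ e, 0 ≤ w e)
    (T : SimpleGraph V) (hTG : T ≤ G) (hT : T.IsTree)
    (hmin : ∀ T' : SimpleGraph V, T' ≤ G → T'.IsTree →
      (∑ᶠ e ∈ T.edgeSet, w e) ≤ ∑ᶠ e ∈ T'.edgeSet, w e)
    (u v : V) (p : T.Walk u v) (hp : p.IsPath) (q : G.Walk u v) :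
    (p.edges.map w).maximum ≤ (q.edges.map w).maximum := by
  classical
  apply List.maximum_le_of_forall_le
  intro r hr
  obtain ⟨e, he, rfl⟩ := List.mem_map.1 hr
  have heT : e ∈ T.edgeSet := p.edges_subset_edgeSet he
  set D := T.deleteEdges {e} with hD
  have hDT : D ≤ T := SimpleGraph.deleteEdges_le _
  have hnr : ¬ D.Reachable u v := by
    intro h
    obtain ⟨d, hd⟩ := h.exists_isPath
    have h1 : d.mapLe hDT = p :=
      congrArg Subtype.val (hT.isAcyclic.path_unique ⟨d.mapLe hDT, hd.mapLe hDT⟩ ⟨p, hp⟩)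
    rw [← h1, SimpleGraph.Walk.edges_mapLe_eq_edges] at he
    have := d.edges_subset_edgeSet he
    simp [hD, SimpleGraph.edgeSet_deleteEdges] at this
  obtain ⟨x, y, hxy, hG', hn⟩ := exists_crossing_dart q hnr
  refine le_trans ?_ (List.le_maximum_of_mem' (List.mem_map_of_mem hxy))
  rw [WithBot.coe_le_coe]
  have hac : (D ⊔ SimpleGraph.edge x y).IsAcyclic :=
    SimpleGraph.IsAcyclic.sup_edge_of_not_reachable hn (hT.isAcyclic.anti hDT)
  have hle : D ⊔ SimpleGraph.edge x y ≤ G :=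
    sup_le (hDT.trans hTG) ((SimpleGraph.edge_le_iff _).2 (Or.inr hG'))
  obtain ⟨T', hT'1, hT'G, hT'⟩ := hG.exists_isTree_le_of_le_of_isAcyclic hle hac
  have hes : (D ⊔ SimpleGraph.edge x y).edgeSet = insert s(x, y) (T.edgeSet \ {e}) := by
    rw [SimpleGraph.edgeSet_sup, SimpleGraph.edgeSet_edge_of_ne hG'.ne, hD,
      SimpleGraph.edgeSet_deleteEdges, Set.union_singleton]
  have hf : s(x, y) ∉ T.edgeSet \ {e} := by
    rw [← SimpleGraph.edgeSet_deleteEdges]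
    intro h
    exact hn (SimpleGraph.Adj.reachable h)
  have hTe : T.edgeSet = insert e (T.edgeSet \ {e}) := by
    simp [Set.insert_eq_of_mem heT]
  have hcard : T'.edgeSet.ncard = T.edgeSet.ncard := by
    have h1 := (SimpleGraph.isTree_iff_connected_and_card.1 hT').2
    have h2 := (SimpleGraph.isTree_iff_connected_and_card.1 hT).2
    rw [Nat.card_coe_set_eq] at h1 h2
    omega
  have heq : insert s(x, y) (T.edgeSet \ {e}) = T'.edgeSet := by
    apply Set.eq_of_subset_of_ncard_le
    · rw [← hes]; exact SimpleGraph.edgeSet_mono hT'1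
    · rw [hcard, Set.ncard_insert_of_notMem hf (Set.toFinite _),
        Set.ncard_sdiff_singleton_add_one heT (Set.toFinite _)]
    · exact Set.toFinite _
  have h := hmin T' hT'G hT'
  rw [← heq, hTe, finsum_mem_insert _ (by simp) (Set.toFinite _), ← hTe,
    finsum_mem_insert _ hf (Set.toFinite _)] at h
  linarith
end

section
/- Let q₀, q₁, …, q_{k−1} be points in ℝ^d (k ≥ 2), let μ > 0, and let 0 = i₀ < i₁ < ⋯ < i_m = k−1 be indices such that for each j < m and every index l with i_j ≤ l < i_{j+1}, one has ‖q_l − q_{i_j}‖ ≤ μ. Let π be the piecewise linear curve through q₀, …, q_{k−1} and let σ be the piecewise linear curve through q_{i₀}, …, q_{i_m} (the μ-simplification of π). Then the (strong) Fréchet distance between π and σ is at most μ. -/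
open Set

/-- A strong reparameterization of `[0,1]`: a continuous strictly increasing
bijection of `[0,1]` onto itself fixing the endpoints. -/
def IsStrongRepar (φ : ℝ → ℝ) : Prop :=
  ContinuousOn φ (Icc 0 1) ∧ StrictMonoOn φ (Icc 0 1) ∧
    MapsTo φ (Icc 0 1) (Icc 0 1) ∧ SurjOn φ (Icc 0 1) (Icc 0 1) ∧
    φ 0 = 0 ∧ φ 1 = 1

/-- The width of a pair of reparameterizations: `sup_{t ∈ [0,1]} ‖f(φ t) − g(ψ t)‖`. -/
noncomputable def reparWidth {d : ℕ} (f g : ℝ → EuclideanSpace ℝ (Fin d))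
    (φ ψ : ℝ → ℝ) : ℝ :=
  ⨆ t : Icc (0:ℝ) 1, ‖f (φ t) - g (ψ t)‖

/-- The (strong) Fréchet distance: infimum of widths over pairs of strong
reparameterizations. -/
noncomputable def frechetDist {d : ℕ} (f g : ℝ → EuclideanSpace ℝ (Fin d)) : ℝ :=
  ⨅ p : {p : (ℝ → ℝ) × (ℝ → ℝ) // IsStrongRepar p.1 ∧ IsStrongRepar p.2},
    reparWidth f g p.1.1 p.1.2

/-- clamp to `[0,1]` -/
noncomputable def clampUnit (x : ℝ) : ℝ := max 0 (min x 1)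

lemma clampUnit_mono : Monotone clampUnit := fun _ _ h =>
  max_le_max le_rfl (min_le_min h le_rfl)

lemma clampUnit_cont : Continuous clampUnit := by unfold clampUnit; fun_prop

lemma clampUnit_of_le {x : ℝ} (h : x ≤ 0) : clampUnit x = 0 := by
  unfold clampUnit
  exact max_eq_left ((min_le_left _ _).trans h)

lemma clampUnit_of_ge {x : ℝ} (h : 1 ≤ x) : clampUnit x = 1 := by
  unfold clampUnit
  rw [min_eq_right h]; norm_num

lemma clampUnit_of_mem {x : ℝ} (h : x ∈ Icc (0:ℝ) 1) : clampUnit x = x := by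
  unfold clampUnit
  rw [min_eq_left h.2, max_eq_right h.1]

/-- piecewise linear interpolation on `[0,n]` -/
noncomputable def interp {E : Type*} [AddCommGroup E] [Module ℝ E] (a : ℕ → E) (n : ℕ) (x : ℝ) : E :=
  a 0 + ∑ l ∈ Finset.range n, clampUnit (x - l) • (a (l + 1) - a l)

lemma interp_apply {E : Type*} [AddCommGroup E] [Module ℝ E] (a : ℕ → E) (n l : ℕ) (hl : l < n)
    (s : ℝ) (hs : s ∈ Icc (0:ℝ) 1) :
    interp a n (l + s) = (1 - s) • a l + s • a (l + 1) := by
  unfold interp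
  obtain ⟨r, rfl⟩ : ∃ r, n = l + 1 + r := ⟨n - (l + 1), by omega⟩
  rw [Finset.sum_range_add, Finset.sum_range_succ]
  have h1 : ∑ x ∈ Finset.range l, clampUnit ((l:ℝ) + s - x) • (a (x + 1) - a x) = a l - a 0 := by
    rw [← Finset.sum_range_sub]
    refine Finset.sum_congr rfl fun x hx => ?_
    rw [Finset.mem_range] at hx
    have : (x:ℝ) + 1 ≤ l := by exact_mod_cast hx
    rw [clampUnit_of_ge (by linarith [hs.1]), one_smul]
  have h2 : ∑ x ∈ Finset.range r, clampUnit ((l:ℝ) + s - ((l + 1 + x : ℕ) : ℝ)) •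
      (a (l + 1 + x + 1) - a (l + 1 + x)) = 0 := by
    refine Finset.sum_eq_zero fun x _ => ?_
    have : (0:ℝ) ≤ x := x.cast_nonneg
    rw [clampUnit_of_le (by push_cast; linarith [hs.2]), zero_smul]
  rw [h1, h2, add_sub_cancel_left, clampUnit_of_mem hs]
  module

lemma interp_cont {E : Type*} [NormedAddCommGroup E] [NormedSpace ℝ E] (a : ℕ → E) (n : ℕ) :
    Continuous (interp a n) := by
  unfold interp
  have := clampUnit_cont
  fun_prop

lemma interp_mono (a : ℕ → ℝ) (ha : Monotone a) (n : ℕ) : Monotone (interp a n) := by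
  intro x y h
  unfold interp
  refine add_le_add le_rfl (Finset.sum_le_sum fun l _ => ?_)
  refine smul_le_smul_of_nonneg_right (clampUnit_mono (by linarith)) ?_
  linarith [ha (Nat.le_succ l)]

lemma exists_nat_add (n : ℕ) (hn : 1 ≤ n) (x : ℝ) (hx : x ∈ Icc (0:ℝ) n) :
    ∃ l < n, ∃ s ∈ Icc (0:ℝ) 1, x = l + s := by
  rcases hx.2.lt_or_eq with h | h
  · refine ⟨⌊x⌋₊, (Nat.floor_lt hx.1).2 h, x - ⌊x⌋₊, ⟨?_, ?_⟩, by ring⟩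
    · linarith [Nat.floor_le hx.1]
    · linarith [Nat.lt_floor_add_one x]
  · refine ⟨n - 1, by omega, 1, by simp, ?_⟩
    rw [h, Nat.cast_sub hn]; simp

lemma isStrongRepar_of {ψ : ℝ → ℝ} (hc : Continuous ψ) (hm : StrictMonoOn ψ (Icc 0 1))
    (h0 : ψ 0 = 0) (h1 : ψ 1 = 1) : IsStrongRepar ψ := by
  refine ⟨hc.continuousOn, hm, ?_, ?_, h0, h1⟩
  · intro x hx
    have a := hm.monotoneOn (by simp) hx hx.1
    have b := hm.monotoneOn hx (by simp) hx.2
    rw [h0] at a; rw [h1] at b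
    exact ⟨a, b⟩
  · have := intermediate_value_Icc (zero_le_one' ℝ) hc.continuousOn
    rwa [h0, h1] at this

/-- A weak reparameterization of the second curve suffices if that curve is continuous. -/
lemma frechetDist_le_of_weak {d : ℕ} {f g : ℝ → EuclideanSpace ℝ (Fin d)} {μ : ℝ} {G : ℝ → ℝ}
    (hg : ContinuousOn g (Icc 0 1)) (hc : Continuous G) (hm : Monotone G)
    (h0 : G 0 = 0) (h1 : G 1 = 1) (h : ∀ t ∈ Icc (0:ℝ) 1, ‖f t - g (G t)‖ ≤ μ) :
    frechetDist f g ≤ μ := by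
  refine le_of_forall_pos_le_add fun ε hε => ?_
  have hu := isCompact_Icc.uniformContinuousOn_of_continuous hg
  obtain ⟨δ, hδ, hu⟩ := Metric.uniformContinuousOn_iff.1 hu ε hε
  obtain ⟨η, hη0, hη1, hηδ⟩ : ∃ η : ℝ, 0 < η ∧ η < 1 ∧ η < δ :=
    ⟨min δ 1 / 2, by positivity, by linarith [min_le_right δ 1],
      by have := min_le_left δ 1; linarith [lt_min hδ one_pos]⟩
  have hG : ∀ t ∈ Icc (0:ℝ) 1, G t ∈ Icc (0:ℝ) 1 := fun t ht =>
    ⟨h0 ▸ hm ht.1, h1 ▸ hm ht.2⟩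
  let ψ : ℝ → ℝ := fun t => (1 - η) * G t + η * t
  have hψ : IsStrongRepar ψ := by
    refine isStrongRepar_of (by fun_prop) ?_ (by simp [ψ, h0]) (by simp [ψ, h1])
    intro x _ y _ hxy
    have a := mul_le_mul_of_nonneg_left (hm hxy.le) (by linarith : 0 ≤ 1 - η)
    have b := mul_lt_mul_of_pos_left hxy hη0
    simp only [ψ]; linarith
  have hid : IsStrongRepar (fun t => t) :=
    isStrongRepar_of continuous_id (fun _ _ _ _ h => h) rfl rfl
  have hb : BddBelow (Set.range fun p : {p : (ℝ → ℝ) × (ℝ → ℝ) //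
      IsStrongRepar p.1 ∧ IsStrongRepar p.2} => reparWidth f g p.1.1 p.1.2) := by
    refine ⟨0, ?_⟩
    rintro _ ⟨p, rfl⟩
    exact Real.iSup_nonneg fun _ => norm_nonneg _
  refine (ciInf_le hb ⟨(fun t => t, ψ), hid, hψ⟩).trans ?_
  haveI : Nonempty (Icc (0:ℝ) 1) := ⟨⟨0, by simp⟩⟩
  refine ciSup_le fun t => ?_
  obtain ⟨t, ht⟩ := t
  have e1 := h t ht
  have e2 : dist (g (G t)) (g (ψ t)) < ε := by
    refine hu _ (hG t ht) _ (hψ.2.2.1 ht) ?_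
    rw [Real.dist_eq]
    have : G t - ψ t = η * (G t - t) := by simp only [ψ]; ring
    rw [this, abs_mul, abs_of_pos hη0]
    have : |G t - t| ≤ 1 := by
      have := hG t ht
      rw [abs_le]; constructor <;> linarith [this.1, this.2, ht.1, ht.2]
    nlinarith
  rw [dist_eq_norm] at e2
  have := norm_sub_le_norm_sub_add_norm_sub (f t) (g (G t)) (g (ψ t))
  simp only
  linarith

lemma frechet_nat {d n m : ℕ} (hn : 1 ≤ n) (hm : 1 ≤ m) (μ : ℝ)
    (Q : ℕ → EuclideanSpace ℝ (Fin d)) (I : ℕ → ℕ)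
    (hmono : ∀ j < m, I j < I (j + 1)) (h0 : I 0 = 0) (hlast : I m = n)
    (hclose : ∀ j < m, ∀ l, I j ≤ l → l < I (j + 1) → ‖Q l - Q (I j)‖ ≤ μ)
    (π σ : ℝ → EuclideanSpace ℝ (Fin d))
    (hπ : ∀ i < n, ∀ s ∈ Icc (0:ℝ) 1,
      π (((i : ℝ) + s) / n) = (1 - s) • Q i + s • Q (i + 1))
    (hσ : ∀ j < m, ∀ s ∈ Icc (0:ℝ) 1,
      σ (((j : ℝ) + s) / m) = (1 - s) • Q (I j) + s • Q (I (j + 1))) :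
    frechetDist π σ ≤ μ := by
  have hnR : (0:ℝ) < n := by exact_mod_cast hn
  have hmR : (0:ℝ) < m := by exact_mod_cast hm
  have hσc : ContinuousOn σ (Icc 0 1) := by
    have : Continuous fun t : ℝ => interp (fun j => Q (I j)) m (t * m) :=
      (interp_cont _ _).comp (by fun_prop)
    refine this.continuousOn.congr fun t ht => ?_
    obtain ⟨j, hj, s, hs, e⟩ := exists_nat_add m hm (t * m)
      ⟨by have := ht.1; positivity, by have := ht.2; nlinarith⟩
    have e' : t = (j + s) / m := by field_simp; linarith
    simp only
    rw [e, interp_apply _ _ _ hj _ hs, e', hσ j hj s hs]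
  let J : ℕ → ℕ := fun l => Nat.findGreatest (fun j => I j ≤ l) m
  have hJmono : Monotone J := fun a b hab =>
    Nat.findGreatest_mono_left (fun j (h : I j ≤ a) => h.trans hab) m
  have hJspec : ∀ l, I (J l) ≤ l := fun l =>
    Nat.findGreatest_spec (P := fun j => I j ≤ l) (Nat.zero_le m) (by simp [h0])
  have hJm : ∀ l, J l ≤ m := fun l => Nat.findGreatest_le m
  have hJge : ∀ l j, j ≤ m → I j ≤ l → j ≤ J l := fun l j hj h => Nat.le_findGreatest hj h
  have hJlt : ∀ l < n, J l < m := fun l hl => by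
    refine lt_of_le_of_ne (hJm l) fun h => ?_
    have := hJspec l
    rw [h, hlast] at this; omega
  have hJnext : ∀ l < n, l < I (J l + 1) := fun l hl => by
    by_contra! h
    have := hJge l _ (hJlt l hl) h
    omega
  have hIm : ∀ a b, a ≤ b → b ≤ m → I a ≤ I b := by
    intro a b hab
    induction hab with
    | refl => intro _; rfl
    | step _ ih => intro hb; exact (ih (by omega)).trans (hmono _ (by omega)).le
  have hJ0 : J 0 = 0 := by
    by_contra h
    have h1 := hIm 1 (J 0) (by omega) (hJm 0)
    have h2 := hmono 0 (by omega)
    have := hJspec 0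
    simp only [zero_add] at h2
    omega
  have hJn : J n = m := le_antisymm (hJm n) (hJge n m le_rfl hlast.le)
  have hJR : Monotone (fun l => (J l : ℝ)) := fun a b h => Nat.cast_le.2 (hJmono h)
  let G : ℝ → ℝ := fun t => interp (fun l => (J l : ℝ)) n (t * n) / m
  have hGv : ∀ l < n, ∀ s ∈ Icc (0:ℝ) 1, G ((l + s) / n) = ((1 - s) * J l + s * J (l + 1)) / m := by
    intro l hl s hs
    simp only [G]
    rw [div_mul_cancel₀ _ hnR.ne', interp_apply _ _ _ hl _ hs]
    simp
  refine frechetDist_le_of_weak (G := G) hσc ?_ ?_ ?_ ?_ ?_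
  · exact ((interp_cont _ _).comp (by fun_prop)).div_const _
  · intro x y h
    exact div_le_div_of_nonneg_right
      (interp_mono _ hJR n (mul_le_mul_of_nonneg_right h hnR.le)) hmR.le
  · have := hGv 0 hn 0 (by simp)
    simpa [hJ0] using this
  · have := hGv (n - 1) (by omega) 1 (by simp)
    rw [Nat.cast_sub hn, Nat.sub_add_cancel hn, hJn] at this
    simpa [hnR.ne', hmR.ne'] using this
  · intro t ht
    obtain ⟨l, hl, s, hs, e⟩ := exists_nat_add n hn (t * n)
      ⟨by have := ht.1; positivity, by have := ht.2; nlinarith⟩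
    have e' : t = (l + s) / n := by field_simp; linarith
    rw [e', hGv l hl s hs, hπ l hl s hs]
    have c1 := hclose (J l) (hJlt l hl) l (hJspec l) (hJnext l hl)
    have hs1 : 0 ≤ 1 - s := by linarith [hs.2]
    rcases (Nat.succ_le_of_lt (hJnext l hl)).lt_or_eq with h | h
    · have hJe : J (l + 1) = J l := by
        refine le_antisymm ?_ (hJmono (Nat.le_succ l))
        by_contra! h'
        have := hIm (J l + 1) (J (l + 1)) h' (hJm _)
        have := hJspec (l + 1)
        omega
      have c2 := hclose (J l) (hJlt l hl) (l + 1) ((hJspec l).trans (Nat.le_succ l)) h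
      have e3 : ((1 - s) * J l + s * J (l + 1)) / m = ((J l : ℝ) + 0) / m := by
        rw [hJe]; ring
      rw [e3, hσ (J l) (hJlt l hl) 0 (by simp)]
      have e4 : (1 - s) • Q l + s • Q (l + 1) -
          ((1 - (0:ℝ)) • Q (I (J l)) + (0:ℝ) • Q (I (J l + 1))) =
          (1 - s) • (Q l - Q (I (J l))) + s • (Q (l + 1) - Q (I (J l))) := by module
      rw [e4]
      refine (norm_add_le _ _).trans ?_
      rw [norm_smul, norm_smul, Real.norm_of_nonneg hs1, Real.norm_of_nonneg hs.1]
      nlinarith [mul_le_mul_of_nonneg_left c1 hs1, mul_le_mul_of_nonneg_left c2 hs.1]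
    · have h : l + 1 = I (J l + 1) := h
      have hJe : J (l + 1) = J l + 1 := by
        refine le_antisymm ?_ (hJge _ _ (hJlt l hl) h.ge)
        by_contra! h'
        have h1 := hIm (J l + 2) (J (l + 1)) h' (hJm _)
        have h2 := hJspec (l + 1)
        have h3 := hmono (J l + 1) (by have := hJm (l + 1); omega)
        have h4 : J l + 1 + 1 = J l + 2 := rfl
        rw [h4] at h3
        omega
      have e3 : ((1 - s) * J l + s * J (l + 1)) / m = ((J l : ℝ) + s) / m := by
        rw [hJe]; push_cast; ring
      rw [e3, hσ (J l) (hJlt l hl) s hs, ← h]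
      have e4 : (1 - s) • Q l + s • Q (l + 1) -
          ((1 - s) • Q (I (J l)) + s • Q (l + 1)) =
          (1 - s) • (Q l - Q (I (J l))) := by module
      rw [e4, norm_smul, Real.norm_of_nonneg hs1]
      nlinarith [mul_le_mul_of_nonneg_left c1 hs1, norm_nonneg (Q l - Q (I (J l))), hs.1]

/-- Let `q₀, …, q_{k−1}` be points in `ℝ^d` (`k ≥ 2`), `μ > 0`, and
`0 = i₀ < i₁ < ⋯ < i_m = k − 1` (given by a strictly monotone `ι`) indices such
that `‖q_l − q_{i_j}‖ ≤ μ` whenever `i_j ≤ l < i_{j+1}`. If `π` is the piecewise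
linear curve through `q₀, …, q_{k−1}` and `σ` the piecewise linear curve through
`q_{i₀}, …, q_{i_m}` (the μ-simplification of `π`), then the (strong) Fréchet
distance between `π` and `σ` is at most `μ`. -/
theorem frechet_simplification_le {d k m : ℕ} (hk : 2 ≤ k) (hm : 1 ≤ m)
    (μ : ℝ) (hμ : 0 < μ)
    (q : Fin k → EuclideanSpace ℝ (Fin d))
    (ι : Fin (m + 1) → Fin k) (hmono : StrictMono ι)
    (h0 : (ι 0 : ℕ) = 0) (hlast : (ι (Fin.last m) : ℕ) = k - 1)
    (hclose : ∀ (j : Fin m) (l : Fin k),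
      ι j.castSucc ≤ l → l < ι j.succ → ‖q l - q (ι j.castSucc)‖ ≤ μ)
    (π σ : ℝ → EuclideanSpace ℝ (Fin d))
    (hπ : ∀ (i : ℕ) (hi : i + 1 < k), ∀ s ∈ Icc (0:ℝ) 1,
      π (((i : ℝ) + s) / ((k : ℝ) - 1)) =
        (1 - s) • q ⟨i, by omega⟩ + s • q ⟨i + 1, hi⟩)
    (hσ : ∀ (j : ℕ) (hj : j < m), ∀ s ∈ Icc (0:ℝ) 1,
      σ (((j : ℝ) + s) / (m : ℝ)) =
        (1 - s) • q (ι ⟨j, by omega⟩) + s • q (ι ⟨j + 1, by omega⟩)) :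
    frechetDist π σ ≤ μ := by
  obtain ⟨n, rfl⟩ : ∃ n, k = n + 1 := ⟨k - 1, by omega⟩
  let I : ℕ → ℕ := fun j => if h : j < m + 1 then (ι ⟨j, h⟩ : ℕ) else 0
  let Q : ℕ → EuclideanSpace ℝ (Fin d) := fun l => if h : l < n + 1 then q ⟨l, h⟩ else 0
  have hI : ∀ j (h : j < m + 1), I j = ι ⟨j, h⟩ := fun j h => by simp only [I, dif_pos h]
  have hQ : ∀ l (h : l < n + 1), Q l = q ⟨l, h⟩ := fun l h => by simp only [Q, dif_pos h]
  have hQI : ∀ j (h : j < m + 1), Q (I j) = q (ι ⟨j, h⟩) := fun j h => by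
    rw [hI j h, hQ _ (ι ⟨j, h⟩).2]
  refine frechet_nat (n := n) (m := m) (by omega) hm μ Q I ?_ ?_ ?_ ?_ π σ ?_ ?_
  · intro j hj
    rw [hI j (by omega), hI (j + 1) (by omega)]
    exact hmono (Fin.mk_lt_mk.2 (Nat.lt_succ_self j))
  · rw [hI 0 (by omega)]; exact h0
  · rw [hI m (by omega)]; exact hlast
  · intro j hj l h1 h2
    rw [hI j (by omega)] at h1
    rw [hI (j + 1) (by omega)] at h2
    have hl : l < n + 1 := h2.trans (ι ⟨j + 1, by omega⟩).2
    rw [hQI j (by omega), hQ l hl]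
    exact hclose ⟨j, hj⟩ ⟨l, hl⟩ h1 h2
  · intro i hi s hs
    have := hπ i (by omega) s hs
    rw [hQ i (by omega), hQ (i + 1) (by omega), ← this]
    push_cast
    rw [add_sub_cancel_right]
  · intro j hj s hs
    rw [hQI j (by omega), hQI (j + 1) (by omega)]
    exact hσ j hj s hs
end

section
/- Let a, b, v ∈ ℝ^d, and let 0 < μ ≤ r be real numbers with ‖b − a‖ ≥ μ. Suppose the segment [a, b] intersects the ball of radius r centered at v, i.e., there exists t₀ ∈ [0,1] with ‖a + t₀·(b − a) − v‖ ≤ r. Then the length of the portion of the segment inside the ball of radius 2r centered at v is at least μ; precisely, ‖b − a‖ · λ({t ∈ [0,1] : ‖a + t·(b − a) − v‖ ≤ 2r}) ≥ μ, where λ is Lebesgue measure on ℝ. -/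
open Set MeasureTheory

/-- If a segment `[a, b]` of length at least `μ` (`0 < μ ≤ r`)
intersects the ball of radius `r` centered at `v`, then the length of the portion
of the segment inside the ball of radius `2r` centered at `v` is at least `μ`. -/
theorem segment_length_in_double_ball {d : ℕ}
    (a b v : EuclideanSpace ℝ (Fin d)) (μ r : ℝ)
    (hμ : 0 < μ) (hμr : μ ≤ r) (hlen : μ ≤ ‖b - a‖)
    (hint : ∃ t₀ ∈ Icc (0:ℝ) 1, ‖a + t₀ • (b - a) - v‖ ≤ r) :
    μ ≤ ‖b - a‖ *
      (volume {t ∈ Icc (0:ℝ) 1 | ‖a + t • (b - a) - v‖ ≤ 2 * r}).toReal := by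
  obtain ⟨t₀, ⟨h0, h1⟩, ht⟩ := hint
  have hL : 0 < ‖b - a‖ := lt_of_lt_of_le hμ hlen
  obtain ⟨s, hs⟩ : ∃ s, s = μ / ‖b - a‖ := ⟨_, rfl⟩
  have hsL : ‖b - a‖ * s = μ := by rw [hs]; field_simp
  have hs0 : 0 < s := by rw [hs]; positivity
  have hs1 : s ≤ 1 := by rw [hs]; exact (div_le_one hL).2 hlen
  obtain ⟨c, hc0, hc1, hct, htc⟩ : ∃ c : ℝ, 0 ≤ c ∧ c + s ≤ 1 ∧ c ≤ t₀ ∧ t₀ ≤ c + s := by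
    rcases le_total s t₀ with h | h
    · exact ⟨t₀ - s, by linarith, by linarith, by linarith, by linarith⟩
    · exact ⟨0, le_refl _, by linarith, h0, by linarith⟩
  have hsub : Icc c (c + s) ⊆ {t ∈ Icc (0:ℝ) 1 | ‖a + t • (b - a) - v‖ ≤ 2 * r} := by
    rintro t ⟨hl, hu⟩
    refine ⟨⟨by linarith, by linarith⟩, ?_⟩
    have e : a + t • (b - a) - v = (a + t₀ • (b - a) - v) + (t - t₀) • (b - a) := by
      module
    have hd : |t - t₀| ≤ s := abs_le.2 ⟨by linarith, by linarith⟩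
    have h2 : ‖(t - t₀) • (b - a)‖ ≤ μ := by
      rw [norm_smul, Real.norm_eq_abs, ← hsL, mul_comm]
      exact mul_le_mul_of_nonneg_left hd hL.le
    rw [e]
    linarith [norm_add_le (a + t₀ • (b - a) - v) ((t - t₀) • (b - a))]
  have hfin : volume {t ∈ Icc (0:ℝ) 1 | ‖a + t • (b - a) - v‖ ≤ 2 * r} ≠ ⊤ :=
    ne_top_of_le_ne_top (by simp [Real.volume_Icc]) (measure_mono (sep_subset (Icc (0:ℝ) 1) _))
  have hm := ENNReal.toReal_mono hfin (measure_mono (μ := volume) hsub)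
  rw [Real.volume_Icc, add_sub_cancel_left, ENNReal.toReal_ofReal hs0.le] at hm
  calc μ = ‖b - a‖ * s := hsL.symm
    _ ≤ _ := mul_le_mul_of_nonneg_left hm hL.le
end

section
/- Let (a_i, b_i), i ∈ I, be a finite family of segments in ℝ^d, let μ > 0, and suppose each segment has length ‖b_i − a_i‖ ≥ μ. Suppose the family is C-packed in the sense that for every center q ∈ ℝ^d and every radius ρ > 0, the total length of the portions of the segments inside the ball of radius ρ centered at q, namely Σ_{i ∈ I} ‖b_i − a_i‖ · λ({t ∈ [0,1] : ‖a_i + t·(b_i − a_i) − q‖ ≤ ρ}), is at most C·ρ. Then for every v ∈ ℝ^d and every r ≥ μ, the number of indices i such that the segment [a_i, b_i] intersects the ball of radius r centered at v is at most 2·C·r/μ. -/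
open Set MeasureTheory

/-- Let `(aᵢ, bᵢ)`, `i ∈ I`, be a finite family of segments in
`ℝ^d`, each of length at least `μ > 0`, that is `C`-packed: for every center `q`
and radius `ρ > 0` the total length of the portions of the segments inside the
ball of radius `ρ` around `q` is at most `C·ρ`. Then for every `v` and every
`r ≥ μ`, at most `2·C·r/μ` of the segments intersect the ball of radius `r`
centered at `v`. -/
theorem packed_segments_ball_count {d : ℕ} {I : Type*} [Fintype I]
    (a b : I → EuclideanSpace ℝ (Fin d)) (μ C : ℝ) (hμ : 0 < μ)
    (hlen : ∀ i, μ ≤ ‖b i - a i‖)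
    (hpack : ∀ (q : EuclideanSpace ℝ (Fin d)) (ρ : ℝ), 0 < ρ →
      (∑ i, ‖b i - a i‖ *
        (volume {t ∈ Icc (0:ℝ) 1 | ‖a i + t • (b i - a i) - q‖ ≤ ρ}).toReal)
        ≤ C * ρ)
    (v : EuclideanSpace ℝ (Fin d)) (r : ℝ) (hr : μ ≤ r) :
    (({i : I | ∃ t ∈ Icc (0:ℝ) 1, ‖a i + t • (b i - a i) - v‖ ≤ r}).ncard : ℝ)
      ≤ 2 * C * r / μ := by
  classical
  have hr0 : 0 < r := lt_of_lt_of_le hμ hr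
  have key : ∀ i, (∃ t ∈ Icc (0:ℝ) 1, ‖a i + t • (b i - a i) - v‖ ≤ r) →
      μ ≤ ‖b i - a i‖ *
        (volume {t ∈ Icc (0:ℝ) 1 | ‖a i + t • (b i - a i) - v‖ ≤ 2 * r}).toReal := by
    rintro i ⟨t, ⟨ht0, ht1⟩, ht⟩
    have hL : 0 < ‖b i - a i‖ := lt_of_lt_of_le hμ (hlen i)
    obtain ⟨δ, hδ⟩ : ∃ δ, δ = μ / ‖b i - a i‖ := ⟨_, rfl⟩
    have hδL : ‖b i - a i‖ * δ = μ := by rw [hδ]; field_simp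
    have hδ0 : 0 < δ := by rw [hδ]; positivity
    have hδ1 : δ ≤ 1 := by rw [hδ]; exact (div_le_one hL).2 (hlen i)
    obtain ⟨c, hc0, hc1, hct, hct'⟩ :
        ∃ c : ℝ, 0 ≤ c ∧ c + δ ≤ 1 ∧ t - δ ≤ c ∧ c ≤ t := by
      rcases le_total δ t with h | h
      · exact ⟨t - δ, by linarith, by linarith, by linarith, by linarith⟩
      · exact ⟨0, by linarith, by linarith, by linarith, by linarith⟩
    have hsub : Icc c (c + δ) ⊆
        {t ∈ Icc (0:ℝ) 1 | ‖a i + t • (b i - a i) - v‖ ≤ 2 * r} := by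
      rintro s ⟨hs1, hs2⟩
      refine ⟨⟨by linarith, by linarith⟩, ?_⟩
      have e : a i + s • (b i - a i) - v
          = (a i + t • (b i - a i) - v) + (s - t) • (b i - a i) := by
        rw [sub_smul]; abel
      have habs : |s - t| ≤ δ := abs_le.2 ⟨by linarith, by linarith⟩
      have h2 : ‖(s - t) • (b i - a i)‖ ≤ μ := by
        rw [norm_smul, Real.norm_eq_abs, ← hδL, mul_comm]
        exact mul_le_mul_of_nonneg_left habs hL.le
      rw [e]
      exact (norm_add_le _ _).trans (by linarith)
    have hfin : volume {t ∈ Icc (0:ℝ) 1 | ‖a i + t • (b i - a i) - v‖ ≤ 2 * r} ≠ ⊤ :=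
      ((measure_mono (fun x hx => hx.1)).trans_lt
        (measure_Icc_lt_top (μ := volume) (a := (0:ℝ)) (b := 1))).ne
    have hvol := ENNReal.toReal_mono hfin (measure_mono (μ := volume) hsub)
    rw [Real.volume_Icc, add_sub_cancel_left, ENNReal.toReal_ofReal hδ0.le] at hvol
    calc μ = ‖b i - a i‖ * δ := hδL.symm
      _ ≤ _ := mul_le_mul_of_nonneg_left hvol hL.le
  have hp := hpack v (2 * r) (by linarith)
  rw [le_div_iff₀ hμ, Set.ncard_eq_toFinset_card', ← nsmul_eq_mul]
  refine (Finset.card_nsmul_le_sum _ (fun i => ‖b i - a i‖ *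
    (volume {t ∈ Icc (0:ℝ) 1 | ‖a i + t • (b i - a i) - v‖ ≤ 2 * r}).toReal) μ ?_).trans ?_
  · intro i hi
    exact key i (by simpa using hi)
  · refine (Finset.sum_le_sum_of_subset_of_nonneg (Finset.subset_univ _) ?_).trans
      (hp.trans (by linarith))
    intro i _ _
    positivity
end
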